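/- Let S, T, X, Y be random variables on finite alphabets such that Y is conditionally independent of (S,T) given X (the joint pmf factorizes as p(s,t,x,y) = p_{S,T,X}(s,t,x)·κ(y|x)), and let λ ≥ 0. Then the conditional fairness bottleneck Lagrangian satisfies L_CFB(λ) = I(S;Y) + I(X;Y|S,T) - λ·I(T;Y|S) = I(X;Y) - (λ+1)·I(T;Y|S) = J_CFB(λ+1); in particular, for fixed p_{S,T,X}, a channel minimizes κ ↦ I(S;Y) + I(X;Y|S,T) - λ·I(T;Y|S) if and only if it minimizes κ ↦ I(X;Y) - (λ+1)·I(T;Y|S). -/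

import Mathlib

open Finset

/-- Shannon entropy of a pmf on a finite alphabet. -/
noncomputable def Hent {α : Type*} [Fintype α] (p : α → ℝ) : ℝ :=
  -∑ a, p a * Real.log (p a)

/-- Shannon mutual information `I(A;B) = H(A) + H(B) - H(A,B)` of a joint pmf. -/
noncomputable def Imi {α β : Type*} [Fintype α] [Fintype β] (p : α × β → ℝ) : ℝ :=
  Hent (fun a => ∑ b, p (a, b)) + Hent (fun b => ∑ a, p (a, b)) - Hent p

/-- Conditional mutual information `I(A;B|Z) = H(Z,A) + H(Z,B) - H(Z,A,B) - H(Z)`,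
conditioning on the first coordinate (which may itself be a product). -/
noncomputable def Icmi {σ α β : Type*} [Fintype σ] [Fintype α] [Fintype β]
    (p : σ × α × β → ℝ) : ℝ :=
  Hent (fun sa : σ × α => ∑ b, p (sa.1, sa.2, b))
    + Hent (fun sb : σ × β => ∑ a, p (sb.1, a, sb.2))
    - Hent p - Hent (fun s => ∑ a, ∑ b, p (s, a, b))

/-- A channel `κ : 𝒳 → pmf(𝒴)`. -/
def IsChannel {X Y : Type*} [Fintype Y] (κ : X → Y → ℝ) : Prop :=
  (∀ x y, 0 ≤ κ x y) ∧ (∀ x, ∑ y, κ x y = 1)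

/-- The joint pmf `p(s,t,x,y) = p_{S,T,X}(s,t,x) · κ(y|x)` induced by a channel,
under which `Y` is conditionally independent of `(S,T)` given `X`. -/
noncomputable def jointOf4 {S T X Y : Type*} (pSTX : S × T × X → ℝ) (κ : X → Y → ℝ) :
    S × T × X × Y → ℝ :=
  fun z => pSTX (z.1, z.2.1, z.2.2.1) * κ z.2.2.1 z.2.2.2

/-- `I(S;Y)` under the induced joint pmf. -/
noncomputable def ISY4 {S T X Y : Type*} [Fintype S] [Fintype T] [Fintype X] [Fintype Y]
    (pSTX : S × T × X → ℝ) (κ : X → Y → ℝ) : ℝ :=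
  Imi (fun q : S × Y => ∑ t, ∑ x, jointOf4 pSTX κ (q.1, t, x, q.2))

/-- `I(X;Y)` under the induced joint pmf. -/
noncomputable def IXY4 {S T X Y : Type*} [Fintype S] [Fintype T] [Fintype X] [Fintype Y]
    (pSTX : S × T × X → ℝ) (κ : X → Y → ℝ) : ℝ :=
  Imi (fun q : X × Y => ∑ s, ∑ t, jointOf4 pSTX κ (s, t, q.1, q.2))

/-- `I(T;Y|S)` under the induced joint pmf. -/
noncomputable def ITYgS {S T X Y : Type*} [Fintype S] [Fintype T] [Fintype X] [Fintype Y]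
    (pSTX : S × T × X → ℝ) (κ : X → Y → ℝ) : ℝ :=
  Icmi (fun z : S × T × Y => ∑ x, jointOf4 pSTX κ (z.1, z.2.1, x, z.2.2))

/-- `I(X;Y|S,T)` under the induced joint pmf. -/
noncomputable def IXYgST {S T X Y : Type*} [Fintype S] [Fintype T] [Fintype X] [Fintype Y]
    (pSTX : S × T × X → ℝ) (κ : X → Y → ℝ) : ℝ :=
  Icmi (fun z : (S × T) × X × Y => jointOf4 pSTX κ (z.1.1, z.1.2, z.2.1, z.2.2))

/-- The conditional fairness bottleneck Lagrangian
`L_CFB(κ,λ) = I(S;Y) + I(X;Y|S,T) - λ·I(T;Y|S)`. -/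
noncomputable def LCFB {S T X Y : Type*} [Fintype S] [Fintype T] [Fintype X] [Fintype Y]
    (pSTX : S × T × X → ℝ) (κ : X → Y → ℝ) (l : ℝ) : ℝ :=
  ISY4 pSTX κ + IXYgST pSTX κ - l * ITYgS pSTX κ

/-- `J_CFB(κ,β) = I(X;Y) - β·I(T;Y|S)`. -/
noncomputable def JCFB {S T X Y : Type*} [Fintype S] [Fintype T] [Fintype X] [Fintype Y]
    (pSTX : S × T × X → ℝ) (κ : X → Y → ℝ) (b : ℝ) : ℝ :=
  IXY4 pSTX κ - b * ITYgS pSTX κ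

/-- Entropy is invariant under relabelling the alphabet. -/
theorem Hent_comp_equiv {α β : Type*} [Fintype α] [Fintype β] (e : α ≃ β) (p : β → ℝ) :
    Hent (fun a => p (e a)) = Hent p := by
  unfold Hent
  rw [Equiv.sum_comp e (fun b => p b * Real.log (p b))]

/-- Chain rule for the output of a channel: the entropy of an input `a` together with the output
of the channel applied to `f a` is the input entropy plus the average output entropy. -/
theorem Hent_mul_channel {A X Y : Type*} [Fintype A] [Fintype Y]
    (q : A → ℝ) (f : A → X) {κ : X → Y → ℝ} (hκ : IsChannel κ) :
    Hent (fun z : A × Y => q z.1 * κ (f z.1) z.2) = Hent q + ∑ a, q a * Hent (κ (f a)) := by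
  unfold Hent
  rw [Fintype.sum_prod_type, ← sum_neg_distrib, ← sum_neg_distrib, ← sum_add_distrib]
  refine sum_congr rfl fun a _ => ?_
  have key : ∀ y, q a * κ (f a) y * Real.log (q a * κ (f a) y)
      = q a * Real.log (q a) * κ (f a) y
        + q a * (κ (f a) y * Real.log (κ (f a) y)) := by
    intro y
    by_cases h1 : q a = 0
    · simp [h1]
    by_cases h2 : κ (f a) y = 0
    · simp [h2]
    rw [Real.log_mul h1 h2]
    ring
  simp only [key, sum_add_distrib, ← mul_sum, hκ.2]
  ring

/-- Chain rule for the Markov chain `(S,T) - X - Y`: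
`I(X;Y) = I(S;Y) + I(T;Y|S) + I(X;Y|S,T)`. -/
theorem IXY4_eq_add {S T X Y : Type*} [Fintype S] [Fintype T] [Fintype X] [Fintype Y]
    (pSTX : S × T × X → ℝ) {κ : X → Y → ℝ} (hκ : IsChannel κ) :
    IXY4 pSTX κ = ISY4 pSTX κ + ITYgS pSTX κ + IXYgST pSTX κ := by
  have hXY := Hent_mul_channel (fun x => ∑ s, ∑ t, pSTX (s, t, x)) id hκ
  have hSTXY := Hent_mul_channel (fun w : (S × T) × X => pSTX (w.1.1, w.1.2, w.2)) Prod.snd hκ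
  rw [← Hent_comp_equiv (Equiv.prodAssoc (S × T) X Y).symm] at hSTXY
  have havg : ∑ w : (S × T) × X, pSTX (w.1.1, w.1.2, w.2) * Hent (κ w.2)
      = ∑ x, (∑ s, ∑ t, pSTX (s, t, x)) * Hent (κ x) := by
    rw [Fintype.sum_prod_type_right]
    simp only [Fintype.sum_prod_type, sum_mul]
  have hX : (fun x => ∑ y, ∑ s, ∑ t, pSTX (s, t, x) * κ x y)
      = fun x => ∑ s, ∑ t, pSTX (s, t, x) := by
    funext x
    simp only [← sum_mul, ← mul_sum, hκ.2, mul_one]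
  have hY : (fun y => ∑ x, ∑ s, ∑ t, pSTX (s, t, x) * κ x y)
      = fun y => ∑ s, ∑ t, ∑ x, pSTX (s, t, x) * κ x y := by
    funext y
    rw [sum_comm]
    exact sum_congr rfl fun s _ => sum_comm
  have hS : (fun s => ∑ t, ∑ y, ∑ x, pSTX (s, t, x) * κ x y)
      = fun s => ∑ y, ∑ t, ∑ x, pSTX (s, t, x) * κ x y :=
    funext fun s => sum_comm
  have hST : (fun w : S × T => ∑ y, ∑ x, pSTX (w.1, w.2, x) * κ x y)
      = fun w => ∑ x, ∑ y, pSTX (w.1, w.2, x) * κ x y :=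
    funext fun w => sum_comm
  have hSTY : Hent (fun w : (S × T) × Y => ∑ x, pSTX (w.1.1, w.1.2, x) * κ x w.2)
      = Hent (fun w : S × T × Y => ∑ x, pSTX (w.1, w.2.1, x) * κ x w.2.2) :=
    Hent_comp_equiv (Equiv.prodAssoc S T Y)
      (fun w : S × T × Y => ∑ x, pSTX (w.1, w.2.1, x) * κ x w.2.2)
  simp only [id, sum_mul, Equiv.prodAssoc_symm_apply] at hXY hSTXY havg
  simp only [IXY4, ISY4, ITYgS, IXYgST, Imi, Icmi, jointOf4]
  rw [hX, hY, hS, hST, hSTY]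
  simp only [← mul_sum, hκ.2, mul_one]
  linarith

/-- The two conditional fairness bottleneck Lagrangians agree. -/
theorem LCFB_eq_JCFB {S T X Y : Type*} [Fintype S] [Fintype T] [Fintype X] [Fintype Y]
    (pSTX : S × T × X → ℝ) {κ : X → Y → ℝ} (hκ : IsChannel κ) (l : ℝ) :
    LCFB pSTX κ l = JCFB pSTX κ (l + 1) := by
  rw [LCFB, JCFB, IXY4_eq_add pSTX hκ]
  ring

/-- If `Y` is conditionally independent of `(S,T)` given `X` (joint pmf induced
by a channel) and `λ ≥ 0`, then `L_CFB(λ) = I(S;Y) + I(X;Y|S,T) - λ·I(T;Y|S)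
= I(X;Y) - (λ+1)·I(T;Y|S) = J_CFB(λ+1)`; in particular, for fixed `p_{S,T,X}`,
a channel minimizes `κ ↦ L_CFB(κ,λ)` over all channels if and only if it
minimizes `κ ↦ J_CFB(κ,λ+1)`. -/
theorem statement6 {S T X Y : Type*} [Fintype S] [Fintype T] [Fintype X] [Fintype Y]
    (pSTX : S × T × X → ℝ) (hp0 : ∀ z, 0 ≤ pSTX z) (hp1 : ∑ z, pSTX z = 1)
    (l : ℝ) (hl : 0 ≤ l)
    (κstar : X → Y → ℝ) (hκstar : IsChannel κstar) :
    (LCFB pSTX κstar l = JCFB pSTX κstar (l + 1))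
    ∧ ((∀ κ : X → Y → ℝ, IsChannel κ → LCFB pSTX κstar l ≤ LCFB pSTX κ l)
        ↔ (∀ κ : X → Y → ℝ, IsChannel κ →
            JCFB pSTX κstar (l + 1) ≤ JCFB pSTX κ (l + 1))) := by
  refine ⟨LCFB_eq_JCFB pSTX hκstar l, forall₂_congr fun κ hκ => ?_⟩
  rw [LCFB_eq_JCFB pSTX hκstar, LCFB_eq_JCFB pSTX hκ]
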